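/- (Jarník) Let m > 2 and let Θ be an n×m real matrix with ψ_Θ(t) > 0 for all t > 0. Suppose α(Θ) is finite and α(Θ) > (5m²)^{m−1}. Then β(Θ) ≥ α(Θ)^{m/(m−1)} − 3α(Θ). -/

import Mathlib

open Filter
open scoped ENNReal

/-- Distance from a real number to the nearest integer. -/
noncomputable def nid (x : ℝ) : ℝ := |x - round x|

/-- Sup-norm height `M(x) = max_i |x_i|` of an integer vector. -/
def heightM {m : ℕ} (x : Fin m → ℤ) : ℕ := Finset.univ.sup fun i => (x i).natAbs

/-- `ψ_Θ(t) = min { max_j ‖L_j(x)‖ : x ∈ ℤ^m, 0 < M(x) ≤ t }`, valued in `ℝ≥0∞`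
(the infimum over the empty family is `⊤`). -/
noncomputable def psiFn {n m : ℕ} (Θ : Matrix (Fin n) (Fin m) ℝ) (t : ℝ) : ℝ≥0∞ :=
  ⨅ (x : Fin m → ℤ) (_ : x ≠ 0) (_ : (heightM x : ℝ) ≤ t),
    ENNReal.ofReal (⨆ j : Fin n, nid (∑ i, Θ j i * (x i : ℝ)))

/-- The set `{γ > 0 : limsup_{t→∞} t^γ ψ_Θ(t) < ∞}`. -/
noncomputable def uniformExps {n m : ℕ} (Θ : Matrix (Fin n) (Fin m) ℝ) : Set ℝ :=
  {γ : ℝ | 0 < γ ∧ limsup (fun t : ℝ => ENNReal.ofReal (t ^ γ) * psiFn Θ t) atTop < ⊤}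

/-- The set `{γ > 0 : liminf_{t→∞} t^γ ψ_Θ(t) < ∞}`. -/
noncomputable def individualExps {n m : ℕ} (Θ : Matrix (Fin n) (Fin m) ℝ) : Set ℝ :=
  {γ : ℝ | 0 < γ ∧ liminf (fun t : ℝ => ENNReal.ofReal (t ^ γ) * psiFn Θ t) atTop < ⊤}

/-- The uniform Diophantine exponent `α(Θ)`, valued in `ℝ≥0∞`. -/
noncomputable def alphaExp {n m : ℕ} (Θ : Matrix (Fin n) (Fin m) ℝ) : ℝ≥0∞ :=
  sSup (ENNReal.ofReal '' uniformExps Θ)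

/-- The individual Diophantine exponent `β(Θ)`, valued in `ℝ≥0∞`. -/
noncomputable def betaExp {n m : ℕ} (Θ : Matrix (Fin n) (Fin m) ℝ) : ℝ≥0∞ :=
  sSup (ENNReal.ofReal '' individualExps Θ)


lemma abs_det_le_prod {ι : Type*} [Fintype ι] [DecidableEq ι] (M : Matrix ι ι ℤ) (H : ι → ℝ)
    (hM : ∀ j i, |(M j i : ℝ)| ≤ H i) :
    |(M.det : ℝ)| ≤ (Fintype.card ι).factorial * ∏ i, H i := by
  rw [Matrix.det_apply']
  push_cast
  refine (Finset.abs_sum_le_sum_abs _ _).trans ?_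
  have : ∀ σ ∈ (Finset.univ : Finset (Equiv.Perm ι)),
      |(((Equiv.Perm.sign σ : ℤˣ) : ℤ) : ℝ) * ∏ i, (M (σ i) i : ℝ)| ≤ ∏ i, H i := by
    intro σ _
    rw [abs_mul]
    have h1 : |(((Equiv.Perm.sign σ : ℤˣ) : ℤ) : ℝ)| = 1 := by
      rcases Int.units_eq_one_or (Equiv.Perm.sign σ) with h | h <;> simp [h]
    rw [h1, one_mul, Finset.abs_prod]
    exact Finset.prod_le_prod (fun i _ => abs_nonneg _) (fun i _ => hM _ _)
  refine (Finset.sum_le_card_nsmul _ _ _ this).trans ?_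
  rw [Finset.card_univ, Fintype.card_perm, nsmul_eq_mul]

lemma exists_minor {ι P : Type} [Fintype ι] [DecidableEq ι] [Fintype P] (v : ι → P → ℝ)
    (hv : LinearIndependent ℝ v) :
    ∃ f : ι → P, (Matrix.of fun j i => v i (f j)).det ≠ 0 := by
  classical
  have hr : (Matrix.of v).rank = Fintype.card ι := LinearIndependent.rank_matrix hv
  rw [Matrix.rank_eq_finrank_span_cols] at hr
  obtain ⟨κ, a, hinj, hsp, hli⟩ := exists_linearIndependent' ℝ (Matrix.of v).col
  have : Finite κ := Finite.of_injective a hinj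
  have := Fintype.ofFinite κ
  rw [← hsp, finrank_span_eq_card hli] at hr
  let e : ι ≃ κ := (Fintype.equivOfCardEq hr).symm
  refine ⟨a ∘ e, ?_⟩
  have h2 : LinearIndependent ℝ (fun j : ι => ((Matrix.of v).col ∘ a) (e j)) :=
    hli.comp e e.injective
  have h3 : LinearIndependent ℝ (Matrix.of fun j i => v i ((a ∘ e) j)).row := h2
  have h4 := Matrix.linearIndependent_rows_iff_isUnit.mp h3
  exact ((Matrix.isUnit_iff_isUnit_det _).mp h4).ne_zero

lemma cramer_bound {ι P : Type} [Fintype ι] [Fintype P] (v : ι → P → ℤ)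
    (hv : LinearIndependent ℝ (fun i => (fun p => (v i p : ℝ)))) (w : P → ℤ)
    (hw : (fun p => (w p : ℝ)) ∈ Submodule.span ℝ (Set.range (fun i => (fun p => (v i p : ℝ)))))
    (H : ι → ℝ) (Hw : ℝ) (hH1 : ∀ i, 1 ≤ H i) (hHw1 : 1 ≤ Hw)
    (hH : ∀ i p, |(v i p : ℝ)| ≤ H i) (hHw : ∀ p, |(w p : ℝ)| ≤ Hw) :
    ∃ (N : ℤ) (c : ι → ℤ), N ≠ 0 ∧ (∀ p, N * w p = ∑ i, c i * v i p) ∧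
      |(N : ℝ)| ≤ (Fintype.card ι).factorial * (Hw * ∏ i, H i) ∧
      ∀ i, |(c i : ℝ)| ≤ (Fintype.card ι).factorial * (Hw * ∏ i, H i) := by
  classical
  obtain ⟨f, hf⟩ := exists_minor _ hv
  obtain ⟨lam, hlam⟩ := (Submodule.mem_span_range_iff_exists_fun ℝ).mp hw
  have hlam' : ∀ p, (w p : ℝ) = ∑ i, lam i * (v i p : ℝ) := by
    intro p
    have := congrFun hlam p
    simp [Finset.sum_apply] at this
    exact this.symm
  let M : Matrix ι ι ℤ := Matrix.of fun j i => v i (f j)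
  let b : ι → ℤ := fun j => w (f j)
  have hP1 : 1 ≤ ∏ i, H i := by
    have := Finset.prod_le_prod (s := Finset.univ) (f := fun _ : ι => (1:ℝ)) (g := H)
      (fun _ _ => zero_le_one) (fun i _ => hH1 i)
    simpa using this
  have hMR : M.map (Int.cast : ℤ → ℝ) = Matrix.of fun j i => (v i (f j) : ℝ) := by
    ext j i; simp [M]
  have hdet : ((M.det : ℤ) : ℝ) = (M.map (Int.cast : ℤ → ℝ)).det := by
    have := RingHom.map_det (Int.castRingHom ℝ) M
    simpa using this
  have hcr : ∀ i, ((M.cramer b i : ℤ) : ℝ) = (M.det : ℝ) * lam i := by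
    intro i
    have h1 : ((M.cramer b i : ℤ) : ℝ) =
        (M.map (Int.cast : ℤ → ℝ)).cramer (fun j => (b j : ℝ)) i := by
      rw [Matrix.cramer_apply, Matrix.cramer_apply]
      have := RingHom.map_det (Int.castRingHom ℝ) (M.updateCol i b)
      simp only [Int.coe_castRingHom, RingHom.mapMatrix_apply] at this
      rw [this, Matrix.map_updateCol]
      rfl
    have h2 : (fun j => (b j : ℝ)) = (M.map (Int.cast : ℤ → ℝ)).mulVec lam := by
      ext j
      simp only [b, hlam', Matrix.mulVec, dotProduct, Matrix.map_apply, M, Matrix.of_apply]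
      exact Finset.sum_congr rfl fun i _ => mul_comm _ _
    rw [h1, h2, Matrix.cramer_eq_adjugate_mulVec, Matrix.mulVec_mulVec, Matrix.adjugate_mul,
      hdet, Matrix.smul_mulVec, Matrix.one_mulVec]
    simp
  refine ⟨M.det, M.cramer b, ?_, ?_, ?_, ?_⟩
  · intro h
    apply hf
    rw [← hMR, ← hdet, h]; simp
  · intro p
    have : ((M.det * w p : ℤ) : ℝ) = ((∑ i, M.cramer b i * v i p : ℤ) : ℝ) := by
      rw [Int.cast_mul, Int.cast_sum]
      simp only [Int.cast_mul, hcr]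
      rw [hlam', Finset.mul_sum]
      exact Finset.sum_congr rfl fun i _ => by ring
    exact_mod_cast this
  · refine (abs_det_le_prod M H (fun j i => hH i (f j))).trans ?_
    gcongr
    nlinarith
  · intro i
    rw [Matrix.cramer_apply]
    refine (abs_det_le_prod _ (fun k => if k = i then Hw else H k) ?_).trans ?_
    · intro j k
      by_cases hk : k = i
      · subst hk; simp [b, hHw]
      · simp [hk, M, hH]
    · gcongr
      rw [← Finset.mul_prod_erase _ _ (Finset.mem_univ i),
        ← Finset.mul_prod_erase _ H (Finset.mem_univ i)]
      have he : ∏ x ∈ Finset.univ.erase i, (if x = i then Hw else H x)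
          = ∏ x ∈ Finset.univ.erase i, H x :=
        Finset.prod_congr rfl fun x hx => by simp [Finset.ne_of_mem_erase hx]
      rw [he]
      simp only [if_true]
      have h0 : 0 ≤ ∏ x ∈ Finset.univ.erase i, H x :=
        Finset.prod_nonneg fun x _ => by linarith [hH1 x]
      have := hH1 i
      have : ∏ x ∈ Finset.univ.erase i, H x ≤ H i * ∏ x ∈ Finset.univ.erase i, H x := by
        nlinarith
      nlinarith

/-- dimension of the span of `z k, …, z l`. -/
noncomputable def dimSpan {V : Type*} [AddCommGroup V] [Module ℝ V] (z : ℕ → V) (k l : ℕ) : ℕ :=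
  Module.finrank ℝ (Submodule.span ℝ (z '' Set.Icc k l))

set_option linter.unusedSectionVars false

section
variable {V : Type*} [AddCommGroup V] [Module ℝ V] [FiniteDimensional ℝ V]

lemma dimSpan_anti (z : ℕ → V) {k k' l : ℕ} (h : k ≤ k') : dimSpan z k' l ≤ dimSpan z k l :=
  Submodule.finrank_mono (Submodule.span_mono (Set.image_mono (Set.Icc_subset_Icc_left h)))

lemma dimSpan_anti' (z : ℕ → V) {k l : ℕ} (h : l ≤ k) : dimSpan z k l ≤ dimSpan z l l :=
  dimSpan_anti z h

lemma span_eq_of_dimSpan (z : ℕ → V) {k k' l : ℕ} (h : k ≤ k')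
    (hd : dimSpan z k l ≤ dimSpan z k' l) :
    Submodule.span ℝ (z '' Set.Icc k' l) = Submodule.span ℝ (z '' Set.Icc k l) :=
  Submodule.eq_of_le_of_finrank_le
    (Submodule.span_mono (Set.image_mono (Set.Icc_subset_Icc_left h))) hd

lemma dimSpan_self (z : ℕ → V) (l : ℕ) : dimSpan z l l ≤ 1 := by
  unfold dimSpan
  rw [Set.Icc_self, Set.image_singleton]
  exact (finrank_span_le_card _).trans (by simp)

lemma span_succ (z : ℕ → V) {k l : ℕ} (h : k ≤ l + 1) :
    Submodule.span ℝ (z '' Set.Icc k (l+1)) =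
      Submodule.span ℝ {z (l+1)} ⊔ Submodule.span ℝ (z '' Set.Icc k l) := by
  rw [← Submodule.span_union]
  congr 1
  ext v
  simp only [Set.mem_image, Set.mem_Icc, Set.mem_union, Set.mem_singleton_iff]
  constructor
  · rintro ⟨i, ⟨h1, h2⟩, rfl⟩
    rcases Nat.lt_or_ge i (l+1) with h3 | h3
    · right; exact ⟨i, ⟨h1, by omega⟩, rfl⟩
    · left; congr 1; omega
  · rintro (rfl | ⟨i, ⟨h1, h2⟩, rfl⟩)
    · exact ⟨l+1, ⟨h, le_rfl⟩, rfl⟩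
    · exact ⟨i, ⟨h1, by omega⟩, rfl⟩

lemma dimSpan_succ (z : ℕ → V) {k l : ℕ} (h : k ≤ l + 1) :
    dimSpan z k (l+1) ≤ dimSpan z k l + 1 := by
  unfold dimSpan
  rw [span_succ z h]
  refine (Submodule.finrank_add_le_finrank_add_finrank _ _).trans ?_
  have : Module.finrank ℝ (Submodule.span ℝ {z (l+1)}) ≤ 1 :=
    (finrank_span_le_card _).trans (by simp)
  omega

lemma exists_last (z : ℕ → V) {k l : ℕ} (h : k ≤ l) :
    ∃ c, k ≤ c ∧ c ≤ l ∧ dimSpan z c l = dimSpan z k l ∧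
      (c < l → dimSpan z (c+1) l < dimSpan z k l) := by
  classical
  let S := (Finset.Icc k l).filter (fun c => dimSpan z c l = dimSpan z k l)
  have hne : S.Nonempty := ⟨k, by simp [S, h]⟩
  have hm := S.max'_mem hne
  set c := S.max' hne with hc
  simp only [S, Finset.mem_filter, Finset.mem_Icc] at hm
  refine ⟨c, hm.1.1, hm.1.2, hm.2, fun hcl => ?_⟩
  refine lt_of_le_of_ne (dimSpan_anti z (by omega)) fun heq => ?_
  have : c + 1 ≤ c := by
    conv_rhs => rw [hc]
    apply Finset.le_max'
    simp only [S, Finset.mem_filter, Finset.mem_Icc]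
    exact ⟨⟨by omega, by omega⟩, heq⟩
  omega

lemma chain_claim (z : ℕ → V) (y e : ℕ → ℝ) (m : ℕ) (hm : 2 < m) (γ ρ C : ℝ) (K l : ℕ)
    (hC : ∀ k, K ≤ k → C ≤ y k) (hy0 : ∀ k, 0 ≤ y k)
    (he1 : ∀ k, K ≤ k → γ * y (k+1) ≤ e k)
    (he2 : ∀ k, K ≤ k → e k ≤ γ * (ρ - 1) * y k)
    (hpar : ∀ k l, k < l → 2 ≤ dimSpan z k l)
    (hS : ∀ k c, K ≤ k → k ≤ c → c ≤ l → dimSpan z c l ≤ m - 1 →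
      z k ∈ Submodule.span ℝ (z '' Set.Icc c l) → e c - m * y l - C ≤ e k)
    (hρ : 1 < ρ) (hγ : m * ρ ^ (m - 2) + ρ ≤ γ) :
    ∀ d, d + 1 ≤ m - 1 → ∀ k, K ≤ k → k ≤ l → dimSpan z k l ≤ d + 1 →
      y l ≤ ρ ^ d * y k ∧ y (l+1) ≤ ρ ^ (d+1) * y k := by
  have hγ0 : 0 < γ := by
    have hρ0 : 0 < ρ := by linarith
    have : 0 ≤ m * ρ ^ (m - 2) := by positivity
    linarith
  intro d
  induction d with
  | zero =>
    intro _ k hk hkl hd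
    have : k = l := by
      by_contra hne
      have := hpar k l (by omega)
      omega
    subst this
    refine ⟨by simp, ?_⟩
    have h1 := (he1 k hk).trans (he2 k hk)
    rw [mul_assoc] at h1
    have h2 := le_of_mul_le_mul_left h1 hγ0
    have := hy0 k
    simp only [zero_add, pow_one]
    linarith
  | succ d ih =>
    intro hdm k hk hkl hd
    by_cases hlt : dimSpan z k l ≤ d + 1
    · obtain ⟨h1, h2⟩ := ih (by omega) k hk hkl hlt
      have := hy0 k
      refine ⟨h1.trans ?_, h2.trans ?_⟩ <;>
      · gcongr
        · exact hρ.le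
        · omega
    · obtain ⟨c, hkc, hcl, hcd, hclt⟩ := exists_last z hkl
      have hcl' : c < l := by
        rcases hcl.lt_or_eq with h | h
        · exact h
        · subst h
          have := dimSpan_self z c
          omega
      have hc1 := hclt hcl'
      obtain ⟨h1, h2⟩ := ih (by omega) (c+1) (by omega) (by omega) (by omega)
      have hspan := span_eq_of_dimSpan z hkc hcd.ge
      have hmem : z k ∈ Submodule.span ℝ (z '' Set.Icc c l) := by
        rw [hspan]
        exact Submodule.subset_span ⟨k, ⟨le_rfl, hkl⟩, rfl⟩
      have h3 := hS k c hk hkc hcl (by omega) hmem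
      have h4 := he1 c (by omega)
      have h5 := he2 k hk
      have h6 := hC (c+1) (by omega)
      have hyc := hy0 (c+1)
      have hyk := hy0 k
      have h7 : ρ ^ d * y (c+1) ≤ ρ ^ (m-3) * y (c+1) := by
        gcongr
        · exact hρ.le
        · omega
      -- main estimate
      have h8 : (γ - m * ρ ^ (m-3) - 1) * y (c+1) ≤ γ * (ρ - 1) * y k := by
        have : (m:ℝ) * y l ≤ m * (ρ ^ (m-3) * y (c+1)) := by
          gcongr
          exact h1.trans h7
        linarith
      have h9 : γ * (ρ - 1) ≤ (γ - m * ρ ^ (m-3) - 1) * ρ := by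
        have : ρ ^ (m-2) = ρ ^ (m-3) * ρ := by
          rw [← pow_succ]; congr 1; omega
        rw [this] at hγ
        nlinarith
      have hpos : 0 < γ - m * ρ ^ (m-3) - 1 := by
        have h11 : 0 < γ * (ρ - 1) := mul_pos hγ0 (by linarith)
        exact pos_of_mul_pos_left (h11.trans_le h9) (by linarith)
      have h10 : y (c+1) ≤ ρ * y k := by
        have : (γ - m * ρ ^ (m-3) - 1) * y (c+1) ≤ (γ - m * ρ ^ (m-3) - 1) * (ρ * y k) := by
          rw [← mul_assoc]
          exact h8.trans (by gcongr)
        exact le_of_mul_le_mul_left this hpos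
      have hr0 : 0 ≤ ρ := by linarith
      refine ⟨h1.trans ?_, h2.trans ?_⟩
      · rw [pow_succ, mul_assoc]; gcongr
      · rw [pow_succ _ (d+1), mul_assoc]; gcongr

lemma core_false (z : ℕ → V) (y e : ℕ → ℝ) (m : ℕ) (hm : 2 < m) (γ ρ C : ℝ) (K s : ℕ)
    (hy : Monotone y) (hC : ∀ k, K ≤ k → C ≤ y k) (hy0 : ∀ k, 0 ≤ y k) (hy1 : ∀ k, 0 < y (k+1))
    (he1 : ∀ k, K ≤ k → γ * y (k+1) ≤ e k)
    (he2 : ∀ k, K ≤ k → e k ≤ γ * (ρ - 1) * y k)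
    (hpar : ∀ k l, k < l → 2 ≤ dimSpan z k l)
    (hS : ∀ k c l, K ≤ k → k ≤ c → c ≤ l → dimSpan z c l ≤ m - 1 →
      z k ∈ Submodule.span ℝ (z '' Set.Icc c l) → e c - m * y l - C ≤ e k)
    (hs1 : 1 ≤ s) (hsm : s ≤ m) (hdim : ∃ L, s + 1 ≤ dimSpan z K L)
    (hF : ∀ c l, K ≤ c → c ≤ l → dimSpan z c (l+1) = s + 1 → e c ≤ y (l+1) + m * y l + C)
    (hρ : 1 < ρ) (hγ : m * ρ ^ (m - 2) + ρ ≤ γ)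
    (hγ2 : ρ ^ (m - 1) + m * ρ ^ (m - 2) + 1 < γ) : False := by
  classical
  have hL := Nat.find_spec hdim
  have hmin : ∀ L', L' < Nat.find hdim → dimSpan z K L' < s + 1 := by
    intro L' h
    have := Nat.find_min hdim h
    omega
  generalize Nat.find hdim = L at hL hmin
  have hKL : K < L := by
    by_contra h
    push Not at h
    have h1 : dimSpan z K L ≤ dimSpan z L L := dimSpan_anti' z h
    have := dimSpan_self z L
    omega
  obtain ⟨l, rfl⟩ : ∃ l, L = l + 1 := ⟨L - 1, by omega⟩
  have hl1 := hmin l (by omega)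
  have hKl : K ≤ l := by omega
  have h2 := dimSpan_succ z (show K ≤ l + 1 by omega)
  have hDl : dimSpan z K l = s := by omega
  have hDl1 : dimSpan z K (l+1) = s + 1 := by omega
  obtain ⟨c, hkc, hcl, hcd, hclt⟩ := exists_last z hKl
  have hspan := span_eq_of_dimSpan z hkc hcd.ge
  have hDc : dimSpan z c (l+1) = s + 1 := by
    rw [← hDl1]
    unfold dimSpan
    rw [span_succ z (show K ≤ l + 1 by omega), span_succ z (show c ≤ l + 1 by omega), hspan]
  have hf := hF c l hkc hcl hDc
  have h3 := he1 c hkc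
  have h4 := hC (c+1) (by omega)
  have h5 := hy1 c
  have hest : y l ≤ ρ ^ (m-2) * y (c+1) ∧ y (l+1) ≤ ρ ^ (m-1) * y (c+1) := by
    rcases hcl.lt_or_eq with h | h
    · have h6 := hclt h
      have := chain_claim z y e m hm γ ρ C K l hC hy0 he1 he2 hpar
        (fun k c => hS k c l) hρ hγ (m-2) (by omega) (c+1) (by omega) (by omega) (by omega)
      rw [show m - 2 + 1 = m - 1 by omega] at this
      exact this
    · subst h
      have h7 : 1 ≤ ρ ^ (m-2) := one_le_pow₀ hρ.le
      have h8 : 1 ≤ ρ ^ (m-1) := one_le_pow₀ hρ.le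
      have h9 := hy (Nat.le_succ c)
      constructor
      · nlinarith
      · nlinarith
  obtain ⟨h6, h7⟩ := hest
  have h8 : (m:ℝ) * y l ≤ m * (ρ ^ (m-2) * y (c+1)) := by gcongr
  have h9 : γ * y (c+1) ≤ (ρ ^ (m - 1) + m * ρ ^ (m - 2) + 1) * y (c+1) := by linarith
  have := le_of_mul_le_mul_right h9 h5
  linarith

end

/-- `max_j ‖L_j(x)‖`. -/
noncomputable def errX {n m : ℕ} (Θ : Matrix (Fin n) (Fin m) ℝ) (x : Fin m → ℤ) : ℝ :=
  ⨆ j : Fin n, nid (∑ i, Θ j i * (x i : ℝ))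

/-- The lattice point attached to `x`. -/
noncomputable def zInt {n m : ℕ} (Θ : Matrix (Fin n) (Fin m) ℝ) (x : Fin m → ℤ) :
    Fin m ⊕ Fin n → ℤ :=
  Sum.elim x (fun j => round (∑ i, Θ j i * (x i : ℝ)))

/-- The lattice point attached to `x`, as a real vector. -/
noncomputable def zReal {n m : ℕ} (Θ : Matrix (Fin n) (Fin m) ℝ) (x : Fin m → ℤ) :
    Fin m ⊕ Fin n → ℝ := fun p => (zInt Θ x p : ℝ)

lemma nid_le_errX {n m : ℕ} (Θ : Matrix (Fin n) (Fin m) ℝ) (x : Fin m → ℤ) (j : Fin n) :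
    nid (∑ i, Θ j i * (x i : ℝ)) ≤ errX Θ x :=
  le_ciSup (f := fun j : Fin n => nid (∑ i, Θ j i * (x i : ℝ))) (Set.finite_range _).bddAbove j

lemma errX_nonneg {n m : ℕ} (Θ : Matrix (Fin n) (Fin m) ℝ) (x : Fin m → ℤ) : 0 ≤ errX Θ x :=
  Real.iSup_nonneg fun _ => abs_nonneg _

/-- The error of the `j`-th form on a lattice point. -/
lemma abs_form_le {n m : ℕ} (Θ : Matrix (Fin n) (Fin m) ℝ) (x : Fin m → ℤ) (j : Fin n) :
    |∑ i, Θ j i * (zInt Θ x (Sum.inl i) : ℝ) - (zInt Θ x (Sum.inr j) : ℝ)| ≤ errX Θ x :=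
  nid_le_errX Θ x j

/-- A relation between lattice points bounds errors. -/
lemma rel_err_le {n m : ℕ} (Θ : Matrix (Fin n) (Fin m) ℝ) {κ : Type} [Fintype κ]
    (x : κ → Fin m → ℤ) (c : κ → ℤ) (u : Fin m ⊕ Fin n → ℤ)
    (hu : ∀ p, u p = ∑ k, c k * zInt Θ (x k) p) (R ε : ℝ) (hR : ∀ k, |(c k : ℝ)| ≤ R)
    (hε : ∀ k, errX Θ (x k) ≤ ε) (j : Fin n) :
    |∑ i, Θ j i * (u (Sum.inl i) : ℝ) - (u (Sum.inr j) : ℝ)| ≤ Fintype.card κ * (R * ε) := by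
  have h1 : ∑ i, Θ j i * (u (Sum.inl i) : ℝ) - (u (Sum.inr j) : ℝ) =
      ∑ k, (c k : ℝ) *
        (∑ i, Θ j i * (zInt Θ (x k) (Sum.inl i) : ℝ) - (zInt Θ (x k) (Sum.inr j) : ℝ)) := by
    simp only [hu, mul_sub, Finset.sum_sub_distrib]
    push_cast
    congr 1
    simp only [Finset.mul_sum]
    rw [Finset.sum_comm]
    exact Finset.sum_congr rfl fun _ _ => Finset.sum_congr rfl fun _ _ => by ring
  rw [h1]
  refine (Finset.abs_sum_le_sum_abs _ _).trans ?_
  have := Finset.sum_le_card_nsmul (Finset.univ : Finset κ) (fun k => |(c k : ℝ) *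
        (∑ i, Θ j i * (zInt Θ (x k) (Sum.inl i) : ℝ) - (zInt Θ (x k) (Sum.inr j) : ℝ))|) (R * ε)
    (fun k _ => by
      rw [abs_mul]
      exact mul_le_mul (hR k) ((abs_form_le Θ (x k) j).trans (hε k)) (abs_nonneg _)
        ((abs_nonneg _).trans (hR k)))
  simpa [nsmul_eq_mul] using this

lemma abs_le_heightM {m : ℕ} (x : Fin m → ℤ) (i : Fin m) : |(x i : ℝ)| ≤ heightM x := by
  have : (x i).natAbs ≤ heightM x :=
    Finset.le_sup (f := fun i => (x i).natAbs) (Finset.mem_univ i)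
  have h2 : ((x i).natAbs : ℝ) = |(x i : ℝ)| := by
    rw [Nat.cast_natAbs]; simp
  rw [← h2]
  exact_mod_cast this

lemma one_le_heightM {m : ℕ} {x : Fin m → ℤ} (hx : x ≠ 0) : 1 ≤ heightM x := by
  obtain ⟨i, hi⟩ := Function.ne_iff.mp hx
  have : (x i).natAbs ≤ heightM x :=
    Finset.le_sup (f := fun i => (x i).natAbs) (Finset.mem_univ i)
  have : 0 < (x i).natAbs := Int.natAbs_pos.mpr hi
  omega

lemma zInt_bound {n m : ℕ} (Θ : Matrix (Fin n) (Fin m) ℝ) :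
    ∃ B : ℝ, 1 ≤ B ∧ ∀ x : Fin m → ℤ, x ≠ 0 → ∀ p, |(zInt Θ x p : ℝ)| ≤ B * heightM x := by
  refine ⟨1 + ∑ j, ∑ i, |Θ j i|, ?_, ?_⟩
  · have : 0 ≤ ∑ j, ∑ i, |Θ j i| :=
      Finset.sum_nonneg fun _ _ => Finset.sum_nonneg fun _ _ => abs_nonneg _
    linarith
  · intro x hx p
    have h0 : 0 ≤ ∑ j, ∑ i, |Θ j i| :=
      Finset.sum_nonneg fun _ _ => Finset.sum_nonneg fun _ _ => abs_nonneg _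
    have hh : (1:ℝ) ≤ heightM x := by exact_mod_cast one_le_heightM hx
    rcases p with i | j
    · have := abs_le_heightM x i
      simp only [zInt, Sum.elim_inl]
      nlinarith
    · simp only [zInt, Sum.elim_inr]
      set t := ∑ i, Θ j i * (x i : ℝ) with ht
      have h1 : |t - round t| ≤ 1 / 2 := abs_sub_round t
      have h2 : |t| ≤ (∑ i, |Θ j i|) * heightM x := by
        rw [ht, Finset.sum_mul]
        refine (Finset.abs_sum_le_sum_abs _ _).trans (Finset.sum_le_sum fun i _ => ?_)
        rw [abs_mul]
        exact mul_le_mul_of_nonneg_left (abs_le_heightM x i) (abs_nonneg _)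
      have h3 : ∑ i, |Θ j i| ≤ ∑ j, ∑ i, |Θ j i| :=
        Finset.single_le_sum (f := fun j => ∑ i, |Θ j i|)
          (fun _ _ => Finset.sum_nonneg fun _ _ => abs_nonneg _) (Finset.mem_univ j)
      have h4 : |(round t : ℝ)| ≤ |t| + 1/2 := by
        have := abs_sub_abs_le_abs_sub (round t : ℝ) t
        rw [abs_sub_comm] at this
        linarith
      nlinarith

lemma lossA {n m : ℕ} (Θ : Matrix (Fin n) (Fin m) ℝ) (hn : 0 < n) :
    ∃ C : ℝ, 1 ≤ C ∧ ∀ (κ : Type) [Fintype κ] (x : κ → Fin m → ℤ) (x0 : Fin m → ℤ) (ε : ℝ),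
      (∀ k, x k ≠ 0) → x0 ≠ 0 → LinearIndependent ℝ (fun k => zReal Θ (x k)) →
      zReal Θ x0 ∈ Submodule.span ℝ (Set.range (fun k => zReal Θ (x k))) →
      (∀ k, errX Θ (x k) ≤ ε) → 0 ≤ ε →
      errX Θ x0 ≤ C * (heightM x0 * ∏ k, (heightM (x k) : ℝ)) * ε := by
  obtain ⟨B, hB1, hB⟩ := zInt_bound Θ
  refine ⟨((m + n + 1 : ℕ) : ℝ) * ((m+n).factorial * B ^ (m+n+1)), ?_, ?_⟩
  · have h1 : (1:ℝ) ≤ ((m + n + 1 : ℕ) : ℝ) := by exact_mod_cast Nat.le_add_left _ _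
    have h2 : (1:ℝ) ≤ (m+n).factorial := by exact_mod_cast Nat.factorial_pos _
    have h3 : 1 ≤ B ^ (m+n+1) := one_le_pow₀ hB1
    exact one_le_mul_of_one_le_of_one_le h1 (one_le_mul_of_one_le_of_one_le h2 h3)
  intro κ _ x x0 ε hx hx0 hli hmem hε hε0
  have hcard : Fintype.card κ ≤ m + n := by
    have := hli.fintype_card_le_finrank
    simpa using this
  have hh : ∀ u : Fin m → ℤ, u ≠ 0 → (1:ℝ) ≤ heightM u := fun u hu => by
    exact_mod_cast one_le_heightM hu
  obtain ⟨N, c, hN, hrel, -, hc⟩ := cramer_bound (fun k => zInt Θ (x k)) hli (zInt Θ x0) hmem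
    (fun k => B * heightM (x k)) (B * heightM x0)
    (fun k => one_le_mul_of_one_le_of_one_le hB1 (hh _ (hx k)))
    (one_le_mul_of_one_le_of_one_le hB1 (hh _ hx0))
    (fun k => hB _ (hx k)) (hB _ hx0)
  have : Nonempty (Fin n) := ⟨⟨0, hn⟩⟩
  unfold errX
  refine ciSup_le fun j => ?_
  have h1 := rel_err_le Θ x c (fun p => N * zInt Θ x0 p) hrel _ ε hc hε j
  have h2 : ∑ i, Θ j i * (((N * zInt Θ x0 (Sum.inl i) : ℤ)) : ℝ)
      - ((N * zInt Θ x0 (Sum.inr j) : ℤ) : ℝ) =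
      N * (∑ i, Θ j i * (x0 i : ℝ) - round (∑ i, Θ j i * (x0 i : ℝ))) := by
    simp only [zInt, Sum.elim_inl, Sum.elim_inr]
    push_cast
    rw [mul_sub, Finset.mul_sum]
    congr 1
    exact Finset.sum_congr rfl fun _ _ => by ring
  rw [h2, abs_mul] at h1
  have hN1 : (1:ℝ) ≤ |(N:ℝ)| := by
    exact_mod_cast Int.one_le_abs hN
  have h3 : nid (∑ i, Θ j i * (x0 i : ℝ)) ≤
      |(N:ℝ)| * |∑ i, Θ j i * (x0 i : ℝ) - round (∑ i, Θ j i * (x0 i : ℝ))| := by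
    unfold nid
    exact le_mul_of_one_le_left (abs_nonneg _) hN1
  refine (h3.trans h1).trans ?_
  rw [Finset.prod_mul_distrib, Finset.prod_const, Finset.card_univ]
  have hP : 0 ≤ ∏ k, (heightM (x k) : ℝ) := Finset.prod_nonneg fun _ _ => by positivity
  have hf : ((Fintype.card κ).factorial : ℝ) ≤ (m+n).factorial := by
    exact_mod_cast Nat.factorial_le hcard
  have hp : B ^ (Fintype.card κ) ≤ B ^ (m+n) := pow_le_pow_right₀ hB1 hcard
  have hc' : (Fintype.card κ : ℝ) ≤ ((m+n+1 : ℕ) : ℝ) := by exact_mod_cast (by omega)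
  calc _ ≤ ((m+n+1 : ℕ) : ℝ) * (((m+n).factorial * (B * heightM x0 *
        (B ^ (m+n) * ∏ k, (heightM (x k) : ℝ)))) * ε) := by gcongr
    _ = _ := by rw [pow_succ]; ring

lemma lossB {n m : ℕ} (Θ : Matrix (Fin n) (Fin m) ℝ) :
    ∃ C : ℝ, 1 ≤ C ∧ ∀ (κ : Type) [Fintype κ] (x : κ → Fin m → ℤ) (ε : ℝ),
      (∀ k, x k ≠ 0) → LinearIndependent ℝ (fun k => zReal Θ (x k)) →
      Fintype.card κ = m + 1 →
      (∀ k, errX Θ (x k) ≤ ε) → 0 ≤ ε →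
      1 ≤ C * (∏ k, (heightM (x k) : ℝ)) * ε := by
  classical
  refine ⟨((m + 1 : ℕ) : ℝ) * (m+1).factorial, ?_, ?_⟩
  · have h1 : (1:ℝ) ≤ ((m + 1 : ℕ) : ℝ) := by exact_mod_cast Nat.le_add_left _ _
    have h2 : (1:ℝ) ≤ (m+1).factorial := by exact_mod_cast Nat.factorial_pos _
    exact one_le_mul_of_one_le_of_one_le h1 h2
  intro κ _ x ε hx hli hcard hε hε0
  have hh : ∀ u : Fin m → ℤ, u ≠ 0 → (1:ℝ) ≤ heightM u := fun u hu => by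
    exact_mod_cast one_le_heightM hu
  obtain ⟨κ', a, hinj, hsp, hli'⟩ := exists_linearIndependent' ℝ
    (fun k => (fun i => (x k i : ℝ)))
  have : Finite κ' := Finite.of_injective a hinj
  have := Fintype.ofFinite κ'
  have hcard' : Fintype.card κ' ≤ m := by
    have := hli'.fintype_card_le_finrank
    simpa using this
  obtain ⟨k0, hk0⟩ : ∃ k0, k0 ∉ Set.range a := by
    by_contra h
    push Not at h
    have : Function.Surjective a := fun k => h k
    have := Fintype.card_le_of_surjective a this
    omega
  have hmem : (fun i => (x k0 i : ℝ)) ∈ Submodule.span ℝ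
      (Set.range (fun k => (fun i => (x (a k) i : ℝ)))) := by
    change _ ∈ Submodule.span ℝ (Set.range ((fun k => (fun i => (x k i : ℝ))) ∘ a))
    rw [hsp]
    exact Submodule.subset_span ⟨k0, rfl⟩
  obtain ⟨N, c, hN, hrel, hNb, hc⟩ := cramer_bound (fun k => x (a k)) hli' (x k0) hmem
    (fun k => heightM (x (a k))) (heightM (x k0))
    (fun k => hh _ (hx _)) (hh _ (hx k0)) (fun k => abs_le_heightM _) (abs_le_heightM _)
  set R : ℝ := (Fintype.card κ').factorial * (heightM (x k0) * ∏ k, (heightM (x (a k)) : ℝ))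
  have hR0 : 0 ≤ R := by positivity
  -- the relation on lattice points, indexed by `Option κ'`
  let u : Fin m ⊕ Fin n → ℤ := fun p => N * zInt Θ (x k0) p - ∑ k, c k * zInt Θ (x (a k)) p
  have hul : ∀ i, u (Sum.inl i) = 0 := by
    intro i
    simp only [u, zInt, Sum.elim_inl, hrel i, sub_self]
  have hune : ∃ j, u (Sum.inr j) ≠ 0 := by
    by_contra h
    push Not at h
    have h0 : ∀ p, u p = 0 := fun p => by
      rcases p with i | j
      · exact hul i
      · exact h j
    apply hN
    have hli2 := Fintype.linearIndependent_iff.mp hli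
      (fun k => if k = k0 then (N:ℝ) else -∑ k', if a k' = k then (c k' : ℝ) else 0) ?_ k0
    · simpa using hli2
    · ext p
      have h1 : ((u p : ℤ) : ℝ) = 0 := by rw [h0]; simp
      simp only [u] at h1
      push_cast at h1
      have h2 : ∀ k, (if k = k0 then (N:ℝ) else -∑ k', if a k' = k then (c k' : ℝ) else 0)
          = (if k = k0 then (N:ℝ) else 0) - ∑ k', if a k' = k then (c k' : ℝ) else 0 := by
        intro k
        by_cases hk : k = k0
        · subst hk
          have : ∀ k', a k' ≠ k := fun k' h => hk0 ⟨k', h⟩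
          simp [this]
        · simp [hk]
      simp only [h2, Finset.sum_apply, Pi.smul_apply, smul_eq_mul, Pi.zero_apply, zReal, sub_mul,
        Finset.sum_sub_distrib, ite_mul, zero_mul, Finset.sum_mul]
      rw [Finset.sum_comm]
      simpa using h1
  obtain ⟨j, hj⟩ := hune
  have h1 := rel_err_le Θ (κ := Option κ') (fun o => o.elim (x k0) (fun k => x (a k)))
    (fun o => o.elim N (fun k => - c k)) u (by
      intro p
      rw [Fintype.sum_option]
      simp [u, sub_eq_add_neg]) R ε (by
      rintro (_ | k)
      · exact hNb
      · simpa using hc k) (by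
      rintro (_ | k)
      · exact hε _
      · exact hε _) j
  simp only [hul, Int.cast_zero, mul_zero, Finset.sum_const_zero, zero_sub, abs_neg] at h1
  have h2 : (1:ℝ) ≤ |(u (Sum.inr j) : ℝ)| := by exact_mod_cast Int.one_le_abs hj
  refine (h2.trans h1).trans ?_
  have hprod : (heightM (x k0) : ℝ) * ∏ k, (heightM (x (a k)) : ℝ) ≤ ∏ k, (heightM (x k) : ℝ) := by
    rw [← Finset.mul_prod_erase Finset.univ (fun k => (heightM (x k) : ℝ)) (Finset.mem_univ k0)]
    gcongr
    have e1 : ∏ k, (heightM (x (a k)) : ℝ) =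
        ∏ k ∈ Finset.univ.image a, (heightM (x k) : ℝ) := by
      rw [Finset.prod_image (fun _ _ _ _ h => hinj h)]
    rw [e1]
    have hsub : Finset.univ.image a ⊆ Finset.univ.erase k0 := by
      intro k hk
      obtain ⟨k', -, rfl⟩ := Finset.mem_image.mp hk
      exact Finset.mem_erase.mpr ⟨fun h => hk0 ⟨k', h⟩, Finset.mem_univ _⟩
    rw [← Finset.prod_sdiff hsub]
    refine le_mul_of_one_le_left (Finset.prod_nonneg fun _ _ => by positivity) ?_
    have := Finset.prod_le_prod (s := Finset.univ.erase k0 \ Finset.univ.image a)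
      (f := fun _ => (1:ℝ)) (g := fun k => (heightM (x k) : ℝ))
      (fun _ _ => zero_le_one) (fun i _ => hh _ (hx i))
    simpa using this
  have hf : ((Fintype.card κ').factorial : ℝ) ≤ (m+1).factorial := by
    exact_mod_cast Nat.factorial_le (by omega)
  have hc' : (Fintype.card (Option κ') : ℝ) ≤ ((m+1 : ℕ) : ℝ) := by
    rw [Fintype.card_option]
    exact_mod_cast (by omega)
  calc _ ≤ ((m+1 : ℕ) : ℝ) * (((m+1).factorial * (∏ k, (heightM (x k) : ℝ))) * ε) := by
        gcongr
        exact mul_le_mul hf hprod (by positivity) (by positivity)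
    _ = _ := by ring

lemma finite_heightM_le {m : ℕ} (T : ℕ) : {u : Fin m → ℤ | heightM u ≤ T}.Finite := by
  refine (Set.finite_Icc (fun _ : Fin m => -(T:ℤ)) (fun _ => (T:ℤ))).subset ?_
  intro u hu
  have h : ∀ i, (u i).natAbs ≤ T := fun i =>
    (Finset.le_sup (f := fun i => (u i).natAbs) (Finset.mem_univ i)).trans hu
  constructor
  · intro i; have := h i; simp only; omega
  · intro i; have := h i; simp only; omega

/-- A best approximation vector. -/
def IsBestX {n m : ℕ} (Θ : Matrix (Fin n) (Fin m) ℝ) (x : Fin m → ℤ) : Prop :=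
  x ≠ 0 ∧ ∀ u : Fin m → ℤ, u ≠ 0 → heightM u ≤ heightM x → errX Θ x ≤ errX Θ u

lemma exists_min_le {n m : ℕ} (Θ : Matrix (Fin n) (Fin m) ℝ) (u0 : Fin m → ℤ) (hu0 : u0 ≠ 0) :
    ∃ x : Fin m → ℤ, x ≠ 0 ∧ heightM x ≤ heightM u0 ∧
      ∀ u : Fin m → ℤ, u ≠ 0 → heightM u ≤ heightM u0 → errX Θ x ≤ errX Θ u := by
  have hfin : {u : Fin m → ℤ | u ≠ 0 ∧ heightM u ≤ heightM u0}.Finite :=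
    (finite_heightM_le (heightM u0)).subset fun u hu => hu.2
  obtain ⟨x, hx, hmin⟩ := Set.exists_min_image _ (errX Θ) hfin ⟨u0, hu0, le_rfl⟩
  exact ⟨x, hx.1, hx.2, fun u h1 h2 => hmin u ⟨h1, h2⟩⟩

lemma exists_next {n m : ℕ} (Θ : Matrix (Fin n) (Fin m) ℝ)
    (hpos : ∀ u : Fin m → ℤ, u ≠ 0 → 0 < errX Θ u)
    (hsmall : ∀ ε : ℝ, 0 < ε → ∃ u : Fin m → ℤ, u ≠ 0 ∧ errX Θ u < ε)
    (x : Fin m → ℤ) (hx : IsBestX Θ x) :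
    ∃ x' : Fin m → ℤ, IsBestX Θ x' ∧ heightM x < heightM x' ∧ errX Θ x' < errX Θ x ∧
      ∀ u : Fin m → ℤ, u ≠ 0 → heightM u < heightM x' → errX Θ x ≤ errX Θ u := by
  classical
  have hex : ∃ T : ℕ, ∃ u : Fin m → ℤ, u ≠ 0 ∧ heightM u = T ∧ errX Θ u < errX Θ x := by
    obtain ⟨u, h1, h2⟩ := hsmall _ (hpos x hx.1)
    exact ⟨_, u, h1, rfl, h2⟩
  obtain ⟨u0, hu0, hT, hlt⟩ := Nat.find_spec hex
  have hmin : ∀ u : Fin m → ℤ, u ≠ 0 → heightM u < heightM u0 → errX Θ x ≤ errX Θ u := by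
    intro u hu h
    rw [hT] at h
    have := Nat.find_min hex h
    by_contra hcon
    push Not at hcon
    exact this ⟨u, hu, rfl, hcon⟩
  obtain ⟨x', h1, h2, h3⟩ := exists_min_le Θ u0 hu0
  have h4 : errX Θ x' < errX Θ x := (h3 u0 hu0 le_rfl).trans_lt hlt
  have h5 : heightM x' = heightM u0 := by
    refine le_antisymm h2 ?_
    by_contra h
    push Not at h
    exact absurd (hmin x' h1 h) (not_le.mpr h4)
  refine ⟨x', ⟨h1, fun u hu h => h3 u hu (h5 ▸ h)⟩, ?_, h4, fun u hu h => hmin u hu (h5 ▸ h)⟩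
  by_contra h
  push Not at h
  exact absurd (hx.2 x' h1 h) (not_le.mpr h4)

lemma exists_seq {n m : ℕ} (Θ : Matrix (Fin n) (Fin m) ℝ)
    (hpos : ∀ u : Fin m → ℤ, u ≠ 0 → 0 < errX Θ u)
    (hsmall : ∀ ε : ℝ, 0 < ε → ∃ u : Fin m → ℤ, u ≠ 0 ∧ errX Θ u < ε) :
    ∃ x : ℕ → Fin m → ℤ, (∀ k, x k ≠ 0) ∧ (∀ k, heightM (x k) < heightM (x (k+1))) ∧
      (∀ k, errX Θ (x (k+1)) < errX Θ (x k)) ∧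
      ∀ k, ∀ u : Fin m → ℤ, u ≠ 0 → heightM u < heightM (x (k+1)) → errX Θ (x k) ≤ errX Θ u := by
  obtain ⟨u0, hu0, -⟩ := hsmall 1 one_pos
  obtain ⟨x0, h1, h2, h3⟩ := exists_min_le Θ u0 hu0
  have hb0 : IsBestX Θ x0 := ⟨h1, fun u hu h => h3 u hu (h.trans h2)⟩
  choose f hf using fun x : {x // IsBestX Θ x} => exists_next Θ hpos hsmall x.1 x.2
  let s : ℕ → {x // IsBestX Θ x} := fun k => Nat.rec ⟨x0, hb0⟩ (fun _ x => ⟨f x, (hf x).1⟩) k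
  have hs : ∀ k, (s (k+1)).1 = f (s k) := fun k => rfl
  refine ⟨fun k => (s k).1, fun k => (s k).2.1, ?_, ?_, ?_⟩
  · intro k; simp only [hs]; exact (hf (s k)).2.1
  · intro k; simp only [hs]; exact (hf (s k)).2.2.1
  · intro k; simp only [hs]; exact (hf (s k)).2.2.2

lemma exists_heightM_eq {m : ℕ} (x : Fin m → ℤ) (hx : x ≠ 0) :
    ∃ i, |(x i : ℝ)| = heightM x := by
  obtain ⟨i0, -⟩ := Function.ne_iff.mp hx
  obtain ⟨i, -, hi⟩ := Finset.exists_mem_eq_sup (Finset.univ : Finset (Fin m)) ⟨i0, Finset.mem_univ _⟩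
    (fun i => (x i).natAbs)
  refine ⟨i, ?_⟩
  unfold heightM
  rw [hi, Nat.cast_natAbs]; simp

lemma scale_height {n m : ℕ} (Θ : Matrix (Fin n) (Fin m) ℝ) (x x' : Fin m → ℤ) (hx : x ≠ 0)
    (a b : ℝ) (h : a • zReal Θ x = b • zReal Θ x') : |a| * heightM x ≤ |b| * heightM x' := by
  obtain ⟨i, hi⟩ := exists_heightM_eq x hx
  have h1 := congrFun h (Sum.inl i)
  simp only [Pi.smul_apply, smul_eq_mul, zReal, zInt, Sum.elim_inl] at h1
  rw [← hi, ← abs_mul, h1, abs_mul]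
  exact mul_le_mul_of_nonneg_left (abs_le_heightM _ _) (abs_nonneg _)

lemma scale_err {n m : ℕ} (Θ : Matrix (Fin n) (Fin m) ℝ) (hn : 0 < n) (x x' : Fin m → ℤ)
    (a b : ℝ) (h : a • zReal Θ x = b • zReal Θ x') : |a| * errX Θ x ≤ |b| * errX Θ x' := by
  have : Nonempty (Fin n) := ⟨⟨0, hn⟩⟩
  obtain ⟨j, hj⟩ := exists_eq_ciSup_of_finite (f := fun j : Fin n => nid (∑ i, Θ j i * (x i : ℝ)))
  have hj' : errX Θ x = nid (∑ i, Θ j i * (x i : ℝ)) := hj.symm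
  have h1 : ∀ p, a * (zInt Θ x p : ℝ) = b * (zInt Θ x' p : ℝ) := fun p => congrFun h p
  have h2 : a * (∑ i, Θ j i * (zInt Θ x (Sum.inl i) : ℝ) - (zInt Θ x (Sum.inr j) : ℝ)) =
      b * (∑ i, Θ j i * (zInt Θ x' (Sum.inl i) : ℝ) - (zInt Θ x' (Sum.inr j) : ℝ)) := by
    rw [mul_sub, mul_sub, h1, Finset.mul_sum, Finset.mul_sum]
    congr 1
    refine Finset.sum_congr rfl fun i _ => ?_
    have := h1 (Sum.inl i)
    linear_combination Θ j i * this
  have h3 : nid (∑ i, Θ j i * (x i : ℝ)) =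
    |∑ i, Θ j i * (zInt Θ x (Sum.inl i) : ℝ) - (zInt Θ x (Sum.inr j) : ℝ)| := rfl
  rw [hj', h3, ← abs_mul, h2, abs_mul]
  exact mul_le_mul_of_nonneg_left (abs_form_le Θ x' j) (abs_nonneg _)

lemma two_le_dimSpan {V : Type*} [AddCommGroup V] [Module ℝ V] [FiniteDimensional ℝ V]
    (z : ℕ → V) {k l : ℕ} (hkl : k < l) (h : LinearIndependent ℝ ![z k, z l]) :
    2 ≤ dimSpan z k l := by
  have h1 := finrank_span_eq_card h
  simp only [Fintype.card_fin] at h1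
  refine (show 2 ≤ _ from h1.ge).trans ?_
  refine Submodule.finrank_mono (Submodule.span_mono ?_)
  rintro _ ⟨i, rfl⟩
  fin_cases i
  · exact ⟨k, ⟨le_rfl, hkl.le⟩, rfl⟩
  · exact ⟨l, ⟨hkl.le, le_rfl⟩, rfl⟩

lemma exists_basis {V : Type} [AddCommGroup V] [Module ℝ V] [FiniteDimensional ℝ V]
    (z : ℕ → V) (k l : ℕ) :
    ∃ (κ : Type) (_ : Fintype κ) (a : κ → ℕ), Function.Injective a ∧
      (∀ i, k ≤ a i ∧ a i ≤ l) ∧ LinearIndependent ℝ (fun i => z (a i)) ∧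
      Submodule.span ℝ (Set.range (fun i => z (a i))) = Submodule.span ℝ (z '' Set.Icc k l) ∧
      Fintype.card κ = dimSpan z k l := by
  obtain ⟨κ, a, hinj, hsp, hli⟩ := exists_linearIndependent' ℝ (fun i : Set.Icc k l => z i)
  have : Finite κ := Finite.of_injective a hinj
  have hft := Fintype.ofFinite κ
  have hr : Set.range (fun i : Set.Icc k l => z i) = z '' Set.Icc k l := by
    rw [Set.image_eq_range]
  rw [hr] at hsp
  refine ⟨κ, hft, fun i => (a i : ℕ), fun i j h => hinj (Subtype.ext h), fun i => (a i).2, hli,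
    hsp, ?_⟩
  unfold dimSpan
  rw [← hsp, finrank_span_eq_card hli]

lemma sum_le_card {κ : Type} [Fintype κ] (a : κ → ℕ) (ha : Function.Injective a) (y : ℕ → ℝ)
    (hy : Monotone y) (l s : ℕ) (hal : ∀ i, a i ≤ l + 1) (hs : Fintype.card κ = s + 1) :
    ∑ i, y (a i) ≤ s * y l + y (l+1) := by
  classical
  have h1 : ∀ i, y (a i) ≤ y l + if a i = l + 1 then y (l+1) - y l else 0 := by
    intro i
    split_ifs with h
    · rw [h]; linarith
    · have : a i ≤ l := by have := hal i; omega
      simpa using hy this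
  refine (Finset.sum_le_sum fun i _ => h1 i).trans ?_
  rw [Finset.sum_add_distrib, ← Finset.sum_filter, Finset.sum_const, Finset.sum_const,
    Finset.card_univ, hs]
  have h2 : (Finset.univ.filter fun i => a i = l + 1).card ≤ 1 := by
    refine Finset.card_le_one.mpr fun i hi j hj => ha ?_
    simp only [Finset.mem_filter] at hi hj
    rw [hi.2, hj.2]
  have h3 : y l ≤ y (l+1) := hy (Nat.le_succ l)
  have h4 : (((Finset.univ.filter fun i => a i = l + 1).card : ℕ) : ℝ) ≤ 1 := by exact_mod_cast h2
  simp only [nsmul_eq_mul]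
  push_cast
  nlinarith

lemma tail_stab {V : Type} [AddCommGroup V] [Module ℝ V] [FiniteDimensional ℝ V] (z : ℕ → V) :
    ∃ K0, ∀ k, K0 ≤ k → Submodule.span ℝ (z '' Set.Ici K0) = Submodule.span ℝ (z '' Set.Ici k) := by
  let f : ℕ →o (Submodule ℝ V)ᵒᵈ :=
    ⟨fun k => OrderDual.toDual (Submodule.span ℝ (z '' Set.Ici k)), fun i j h =>
      OrderDual.toDual_le_toDual.mpr
        (Submodule.span_mono (Set.image_mono (Set.Ici_subset_Ici.mpr h)))⟩
  obtain ⟨K0, h⟩ := IsArtinian.monotone_stabilizes f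
  exact ⟨K0, fun k hk => congrArg OrderDual.ofDual (h k hk)⟩

lemma finite_stab {V : Type} [AddCommGroup V] [Module ℝ V] [FiniteDimensional ℝ V] (z : ℕ → V)
    (K : ℕ) : ∃ L, Submodule.span ℝ (z '' Set.Ici K) = Submodule.span ℝ (z '' Set.Icc K L) := by
  let f : ℕ →o Submodule ℝ V :=
    ⟨fun L => Submodule.span ℝ (z '' Set.Icc K L), fun i j h =>
        (Submodule.span_mono (Set.image_mono (Set.Icc_subset_Icc_right h)))⟩
  obtain ⟨L, h⟩ := monotone_stabilizes_iff_noetherian.mpr (inferInstance : IsNoetherian ℝ V) f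
  refine ⟨L, le_antisymm ?_ (Submodule.span_mono (Set.image_mono Set.Icc_subset_Ici_self))⟩
  refine Submodule.span_le.mpr ?_
  rintro _ ⟨i, hi, rfl⟩
  have h1 : z i ∈ f (max L i) := Submodule.subset_span ⟨i, ⟨hi, le_max_right _ _⟩, rfl⟩
  rw [← h _ (le_max_left _ _)] at h1
  exact h1

lemma main_contra {n m : ℕ} (hm : 2 < m) (hn : 0 < n) (Θ : Matrix (Fin n) (Fin m) ℝ)
    (hpos : ∀ u : Fin m → ℤ, u ≠ 0 → 0 < errX Θ u) (γ ρ : ℝ)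
    (hU : ∃ T0 : ℝ, ∀ t : ℝ, T0 ≤ t → ∃ u : Fin m → ℤ, u ≠ 0 ∧ (heightM u : ℝ) ≤ t ∧
      errX Θ u < t ^ (-γ))
    (hI : ∃ T0 : ℝ, ∀ u : Fin m → ℤ, u ≠ 0 → T0 ≤ heightM u →
      (heightM u : ℝ) ^ (-(γ * (ρ - 1))) ≤ errX Θ u)
    (hρ : 1 < ρ) (hγ : m * ρ ^ (m - 2) + ρ ≤ γ)
    (hγ2 : ρ ^ (m - 1) + m * ρ ^ (m - 2) + 1 < γ) : False := by
  classical
  have hγ0 : 0 < γ := by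
    have : 0 ≤ m * ρ ^ (m - 2) := by positivity
    linarith
  obtain ⟨T1, hT1⟩ := hU
  obtain ⟨T2, hT2⟩ := hI
  have hsmall : ∀ ε : ℝ, 0 < ε → ∃ u : Fin m → ℤ, u ≠ 0 ∧ errX Θ u < ε := by
    intro ε hε
    have h1 := (tendsto_rpow_neg_atTop hγ0).eventually (gt_mem_nhds hε)
    obtain ⟨t, ht1, ht2⟩ := (h1.and (eventually_ge_atTop T1)).exists
    obtain ⟨u, hu, -, hue⟩ := hT1 t ht2
    exact ⟨u, hu, hue.trans ht1⟩
  obtain ⟨x, hx0, hxh, hxe, hxb⟩ := exists_seq Θ hpos hsmall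
  have hXmono : StrictMono (fun k => heightM (x k)) := strictMono_nat_of_lt_succ hxh
  have hEanti : StrictAnti (fun k => errX Θ (x k)) := strictAnti_nat_of_succ_lt hxe
  have hX1 : ∀ k, (1:ℝ) ≤ heightM (x k) := fun k => by exact_mod_cast one_le_heightM (hx0 k)
  have hXp : ∀ k, (0:ℝ) < heightM (x k) := fun k => one_pos.trans_le (hX1 k)
  have hEp : ∀ k, 0 < errX Θ (x k) := fun k => hpos _ (hx0 k)
  set y : ℕ → ℝ := fun k => Real.log (heightM (x k)) with hydef
  set e : ℕ → ℝ := fun k => - Real.log (errX Θ (x k)) with hedef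
  set z : ℕ → (Fin m ⊕ Fin n → ℝ) := fun k => zReal Θ (x k) with hzdef
  have hymono : Monotone y := by
    intro i j h
    apply Real.log_le_log (hXp i)
    exact_mod_cast hXmono.monotone h
  have hy0 : ∀ k, 0 ≤ y k := fun k => Real.log_nonneg (hX1 k)
  have hy1 : ∀ k, 0 < y (k+1) := by
    intro k
    apply Real.log_pos
    have := hxh k
    have := one_le_heightM (hx0 k)
    exact_mod_cast (by omega : 1 < heightM (x (k+1)))
  have hXtop : Tendsto (fun k => (heightM (x k) : ℝ)) atTop atTop :=
    tendsto_natCast_atTop_atTop.comp hXmono.tendsto_atTop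
  have hytop : Tendsto y atTop atTop := Real.tendsto_log_atTop.comp hXtop
  have hpar : ∀ k l, k < l → 2 ≤ dimSpan z k l := by
    intro k l hkl
    apply two_le_dimSpan z hkl
    rw [LinearIndependent.pair_iff]
    intro s t hst
    have h1 : s • z k = (-t) • z l := by
      rw [neg_smul]; exact eq_neg_of_add_eq_zero_left hst
    have h2 := scale_height Θ (x l) (x k) (hx0 l) _ _ h1.symm
    have h3 := scale_err Θ hn (x k) (x l) _ _ h1
    rw [abs_neg] at h2 h3
    have h4 : errX Θ (x l) < errX Θ (x k) := hEanti hkl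
    have h5 : (heightM (x k) : ℝ) < heightM (x l) := by exact_mod_cast hXmono hkl
    have ht : t = 0 := by
      by_contra ht
      have ht' : 0 < |t| := abs_pos.mpr ht
      have h6 : |s| < |t| := by
        have : |s| * errX Θ (x k) < |t| * errX Θ (x k) :=
          h3.trans_lt (mul_lt_mul_of_pos_left h4 ht')
        exact lt_of_mul_lt_mul_right this (hEp k).le
      have h7 : |s| * heightM (x k) < |t| * heightM (x l) :=
        mul_lt_mul'' h6 h5 (abs_nonneg _) (hXp k).le
      linarith
    refine ⟨?_, ht⟩
    subst ht
    by_contra hs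
    have := mul_pos (abs_pos.mpr hs) (hEp k)
    simp at h3
    linarith
  -- eventual estimates
  have he1ev : ∀ᶠ k in atTop, γ * y (k+1) ≤ e k := by
    have h1 : ∀ᶠ k in atTop, max T1 1 < heightM (x (k+1)) :=
      (hXtop.comp (tendsto_add_atTop_nat 1)).eventually_gt_atTop (max T1 1)
    filter_upwards [h1] with k hk
    have hlim : Tendsto (fun t : ℝ => γ * Real.log t) (nhdsWithin (heightM (x (k+1)) : ℝ)
        (Set.Iio (heightM (x (k+1)) : ℝ))) (nhds (γ * y (k+1))) :=
      ((Real.continuousAt_log (hXp (k+1)).ne').tendsto.const_mul γ).mono_left nhdsWithin_le_nhds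
    refine le_of_tendsto hlim ?_
    have h2 : ∀ᶠ t in nhdsWithin (heightM (x (k+1)) : ℝ) (Set.Iio (heightM (x (k+1)) : ℝ)),
        max T1 1 < t := nhdsWithin_le_nhds (lt_mem_nhds hk)
    filter_upwards [h2, self_mem_nhdsWithin] with t ht1 ht2
    obtain ⟨u, hu, hut, hue⟩ := hT1 t ((le_max_left _ _).trans ht1.le)
    have ht0 : 0 < t := one_pos.trans ((le_max_right _ _).trans_lt ht1)
    have h3 : heightM u < heightM (x (k+1)) := by
      exact_mod_cast hut.trans_lt ht2
    have h4 := (hxb k u hu h3).trans hue.le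
    have h5 := Real.log_le_log (hEp k) h4
    rw [Real.log_rpow ht0] at h5
    simp only [hedef]
    linarith
  have he2ev : ∀ᶠ k in atTop, e k ≤ γ * (ρ - 1) * y k := by
    filter_upwards [hXtop.eventually_ge_atTop T2] with k hk
    have h1 := hT2 (x k) (hx0 k) hk
    have h2 := Real.log_le_log (Real.rpow_pos_of_pos (hXp k) _) h1
    rw [Real.log_rpow (hXp k)] at h2
    simp only [hedef, hydef]
    linarith
  obtain ⟨CA, hCA1, hCA⟩ := lossA Θ hn
  obtain ⟨CB, hCB1, hCB⟩ := lossB Θ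
  obtain ⟨K0, hK0⟩ := tail_stab z
  set C : ℝ := Real.log CA + Real.log CB + y K0 + |e K0| with hCdef
  have hlA : 0 ≤ Real.log CA := Real.log_nonneg hCA1
  have hlB : 0 ≤ Real.log CB := Real.log_nonneg hCB1
  obtain ⟨K1, hK1⟩ := eventually_atTop.mp (he1ev.and (he2ev.and (hytop.eventually_ge_atTop C)))
  set K := max K0 K1 with hKdef
  have hKK0 : K0 ≤ K := le_max_left _ _
  have hKK1 : K1 ≤ K := le_max_right _ _
  set r := Module.finrank ℝ (Submodule.span ℝ (z '' Set.Ici K0)) with hrdef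
  have hr2 : 2 ≤ r := (hpar K0 (K0+1) (Nat.lt_succ_self _)).trans
    (Submodule.finrank_mono (Submodule.span_mono (Set.image_mono Set.Icc_subset_Ici_self)))
  -- log form of the first loss estimate
  have hlossA : ∀ (κ : Type) [Fintype κ] (a : κ → ℕ) (k c : ℕ),
      LinearIndependent ℝ (fun i => z (a i)) →
      z k ∈ Submodule.span ℝ (Set.range (fun i => z (a i))) → (∀ i, c ≤ a i) →
      e c - (y k + ∑ i, y (a i)) - Real.log CA ≤ e k := by
    intro κ _ a k c hli hmem hc
    have h1 := hCA κ (fun i => x (a i)) (x k) (errX Θ (x c)) (fun i => hx0 _) (hx0 k) hli hmem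
      (fun i => hEanti.antitone (hc i)) (hEp c).le
    have hP : 0 < ∏ i, (heightM (x (a i)) : ℝ) := Finset.prod_pos fun i _ => hXp _
    have h2 := Real.log_le_log (hEp k) h1
    rw [Real.log_mul (by have := hXp k; positivity) (hEp c).ne',
      Real.log_mul (by positivity) (by have := hXp k; positivity),
      Real.log_mul (hXp k).ne' hP.ne', Real.log_prod (fun i _ => (hXp _).ne')] at h2
    simp only [hedef, hydef]
    linarith
  refine core_false z y e m hm γ ρ C K (min (r-1) m) hymono ?_ hy0 hy1 ?_ ?_ hpar ?_ ?_ ?_ ?_ ?_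
    hρ hγ hγ2
  · exact fun k hk => (hK1 k (hKK1.trans hk)).2.2
  · exact fun k hk => (hK1 k (hKK1.trans hk)).1
  · exact fun k hk => (hK1 k (hKK1.trans hk)).2.1
  · intro k c l hk hkc hcl hd hmem
    obtain ⟨κ, hft, a, hinj, hal, hli, hsp, hcard⟩ := exists_basis z c l
    have h1 := hlossA κ a k c hli (by rw [hsp]; exact hmem) (fun i => (hal i).1)
    have h2 : ∑ i, y (a i) ≤ (m - 1) * y l := by
      refine (Finset.sum_le_card_nsmul _ _ (y l) (fun i _ => hymono (hal i).2)).trans ?_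
      rw [nsmul_eq_mul, Finset.card_univ, hcard]
      have h3 : ((dimSpan z c l : ℕ) : ℝ) ≤ ((m - 1 : ℕ) : ℝ) := by exact_mod_cast hd
      rw [Nat.cast_sub (by omega)] at h3
      push_cast at h3
      exact mul_le_mul_of_nonneg_right h3 (hy0 l)
    have h3 : y k ≤ y l := hymono (hkc.trans hcl)
    have h4 := hy0 K0
    have h5 := abs_nonneg (e K0)
    linarith
  · omega
  · exact min_le_right _ _
  · obtain ⟨L, hL⟩ := finite_stab z K
    refine ⟨L, ?_⟩
    have : dimSpan z K L = r := by
      unfold dimSpan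
      rw [← hL, ← hK0 K hKK0]
    omega
  · intro c l hc hcl hd
    obtain ⟨κ, hft, a, hinj, hal, hli, hsp, hcard⟩ := exists_basis z c (l+1)
    rw [hd] at hcard
    have hsum := sum_le_card a hinj y hymono l _ (fun i => (hal i).2) hcard
    have hs : ((min (r-1) m : ℕ) : ℝ) * y l ≤ m * y l := by
      have : ((min (r-1) m : ℕ) : ℝ) ≤ m := by exact_mod_cast min_le_right _ _
      exact mul_le_mul_of_nonneg_right this (hy0 l)
    have h4 := hy0 K0
    have h5 := neg_abs_le (e K0)
    have h5' := le_abs_self (e K0)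
    by_cases hr : r ≤ m + 1
    · have hW : Submodule.span ℝ (z '' Set.Icc c (l+1)) = Submodule.span ℝ (z '' Set.Ici K0) := by
        refine Submodule.eq_of_le_of_finrank_le (Submodule.span_mono (Set.image_mono ?_)) ?_
        · intro i hi
          exact (hKK0.trans hc).trans hi.1
        · change r ≤ dimSpan z c (l+1)
          omega
      have h1 := hlossA κ a K0 c hli (by
        rw [hsp, hW]
        exact Submodule.subset_span ⟨K0, Set.self_mem_Ici, rfl⟩) (fun i => (hal i).1)
      linarith
    · have h1 := hCB κ (fun i => x (a i)) (errX Θ (x c)) (fun i => hx0 _) hli (by omega)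
        (fun i => hEanti.antitone (hal i).1) (hEp c).le
      have hP : 0 < ∏ i, (heightM (x (a i)) : ℝ) := Finset.prod_pos fun i _ => hXp _
      have h2 := Real.log_le_log one_pos h1
      rw [Real.log_mul (by positivity) (hEp c).ne',
        Real.log_mul (by positivity) hP.ne', Real.log_prod (fun i _ => (hXp _).ne'),
        Real.log_one] at h2
      have h6 : e c ≤ Real.log CB + ∑ i, y (a i) := by
        simp only [hedef, hydef]
        linarith
      linarith [abs_nonneg (e K0)]

lemma psiFn_le {n m : ℕ} (Θ : Matrix (Fin n) (Fin m) ℝ) (u : Fin m → ℤ) (hu : u ≠ 0) (t : ℝ)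
    (ht : (heightM u : ℝ) ≤ t) : psiFn Θ t ≤ ENNReal.ofReal (errX Θ u) :=
  iInf_le_of_le u (iInf_le_of_le hu (iInf_le_of_le ht le_rfl))

lemma pow_add_two_ge (ρ : ℝ) (hρ : 0 ≤ ρ) (N : ℕ) :
    ρ ^ (N + 1) + 2 * (N + 1) * ρ ^ N ≤ (ρ + 2) ^ (N + 1) := by
  induction N with
  | zero => simp
  | succ N ih =>
    have h1 : (ρ + 2) ^ (N + 1 + 1) = (ρ + 2) ^ (N + 1) * (ρ + 2) := pow_succ _ _
    rw [h1]
    have h2 := mul_le_mul_of_nonneg_right ih (by linarith : (0:ℝ) ≤ ρ + 2)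
    refine le_trans ?_ h2
    have h3 : 0 ≤ (N + 1 : ℝ) * ρ ^ N := by positivity
    push_cast
    have e : (ρ ^ (N + 1) + 2 * (N + 1) * ρ ^ N) * (ρ + 2)
      = ρ ^ (N + 1 + 1) + 2 * (N + 1 + 1) * ρ ^ (N + 1) + 4 * ((N + 1 : ℝ) * ρ ^ N) := by ring
    rw [e]; linarith

lemma hU_of_mem {n m : ℕ} (Θ : Matrix (Fin n) (Fin m) ℝ) (γ' γ : ℝ) (hγ' : γ' ∈ uniformExps Θ)
    (h : γ < γ') : ∃ T0 : ℝ, ∀ t : ℝ, T0 ≤ t → ∃ u : Fin m → ℤ, u ≠ 0 ∧ (heightM u : ℝ) ≤ t ∧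
      errX Θ u < t ^ (-γ) := by
  obtain ⟨_, hl⟩ := hγ'
  obtain ⟨M, hM1, hM2⟩ := exists_between hl
  have hev := eventually_lt_of_limsup_lt hM1
  have htend := tendsto_rpow_atTop (sub_pos.2 h)
  have hev2 := htend.eventually_gt_atTop M.toReal
  obtain ⟨T0, hT⟩ := eventually_atTop.1 ((hev.and hev2).and (eventually_gt_atTop (0:ℝ)))
  refine ⟨T0, fun t ht => ?_⟩
  obtain ⟨⟨h1, h2⟩, h0⟩ := hT t ht
  have h3 : M < ENNReal.ofReal (t ^ (γ' - γ)) := by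
    rw [ENNReal.lt_ofReal_iff_toReal_lt hM2.ne]; exact h2
  have h4 : psiFn Θ t < ENNReal.ofReal (t ^ (-γ)) := by
    by_contra hc
    push Not at hc
    have h5 : ENNReal.ofReal (t ^ γ') * ENNReal.ofReal (t ^ (-γ)) ≤
        ENNReal.ofReal (t ^ γ') * psiFn Θ t := by gcongr
    rw [← ENNReal.ofReal_mul (by positivity), ← Real.rpow_add h0, ← sub_eq_add_neg] at h5
    exact absurd (h5.trans_lt (h1.trans h3)) (lt_irrefl _)
  unfold psiFn at h4
  simp only [iInf_lt_iff] at h4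
  obtain ⟨u, hu, hut, hlt⟩ := h4
  exact ⟨u, hu, hut, (ENNReal.ofReal_lt_ofReal_iff (by positivity)).1 hlt⟩

lemma hI_of_notMem {n m : ℕ} (Θ : Matrix (Fin n) (Fin m) ℝ) (b : ℝ) (hb0 : 0 < b)
    (hb : b ∉ individualExps Θ) : ∃ T0 : ℝ, ∀ u : Fin m → ℤ, u ≠ 0 → T0 ≤ heightM u →
      (heightM u : ℝ) ^ (-b) ≤ errX Θ u := by
  have htop : ¬ liminf (fun t : ℝ => ENNReal.ofReal (t ^ b) * psiFn Θ t) atTop < ⊤ :=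
    fun h => hb ⟨hb0, h⟩
  have hlt : (1 : ℝ≥0∞) < liminf (fun t : ℝ => ENNReal.ofReal (t ^ b) * psiFn Θ t) atTop := by
    rw [not_lt_top_iff.1 htop]; exact ENNReal.one_lt_top
  obtain ⟨T0, hT⟩ := eventually_atTop.1 (eventually_lt_of_lt_liminf hlt)
  refine ⟨T0, fun u hu hTu => ?_⟩
  have h1 := hT _ hTu
  have hh : (0:ℝ) < heightM u := by exact_mod_cast one_le_heightM hu
  have h2 : (1 : ℝ≥0∞) < ENNReal.ofReal ((heightM u : ℝ) ^ b * errX Θ u) := by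
    rw [ENNReal.ofReal_mul (by positivity)]
    refine h1.trans_le ?_
    gcongr
    exact psiFn_le Θ u hu _ le_rfl
  rw [ENNReal.one_lt_ofReal] at h2
  have hp : 0 < (heightM u : ℝ) ^ b := by positivity
  rw [Real.rpow_neg hh.le, inv_le_iff_one_le_mul₀ hp, mul_comm]
  exact h2.le

/-- **Jarník's theorem, case (iii) (`m > 2`).** For an `n × m` real matrix `Θ` with `m > 2`,
`ψ_Θ(t) > 0` for all `t > 0`, `α(Θ)` finite and `α(Θ) > (5m²)^{m−1}`, one has
`β(Θ) ≥ α(Θ)^{m/(m−1)} − 3α(Θ)`. -/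
theorem jarnik_m_gt_two {n m : ℕ} (hm : 2 < m) (Θ : Matrix (Fin n) (Fin m) ℝ)
    (hpos : ∀ t : ℝ, 0 < t → 0 < psiFn Θ t)
    (hfin : alphaExp Θ ≠ ⊤)
    (hbig : (5 * (m : ℝ) ^ 2) ^ (m - 1) < (alphaExp Θ).toReal) :
    ENNReal.ofReal
        ((alphaExp Θ).toReal ^ ((m : ℝ) / ((m : ℝ) - 1)) - 3 * (alphaExp Θ).toReal) ≤
      betaExp Θ := by

  obtain ⟨k, rfl⟩ : ∃ k, m = k + 3 := ⟨m - 3, by omega⟩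
  have hpos' : ∀ u : Fin (k + 3) → ℤ, u ≠ 0 → 0 < errX Θ u := by
    intro u hu
    have hh : (0:ℝ) < heightM u := by exact_mod_cast one_le_heightM hu
    have := (hpos _ hh).trans_le (psiFn_le Θ u hu _ le_rfl)
    exact ENNReal.ofReal_pos.1 this
  have hn : 0 < n := by
    rcases Nat.eq_zero_or_pos n with rfl | h
    · exfalso
      have h1 := hpos' (fun _ => 1) (fun h => by simpa using congrFun h 0)
      unfold errX at h1
      simp at h1
    · exact h
  by_contra hcon
  rw [not_le] at hcon
  set A := (alphaExp Θ).toReal with hA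
  have hk0 : (0:ℝ) ≤ k := Nat.cast_nonneg k
  have hApos : 0 < A := lt_of_le_of_lt (by positivity) hbig
  obtain ⟨q, hq⟩ : ∃ q : ℝ, q = A ^ ((1:ℝ) / ((k:ℝ) + 2)) := ⟨_, rfl⟩
  have hqpos : 0 < q := hq ▸ Real.rpow_pos_of_pos hApos _
  have hqA : q ^ (k + 2) = A := by
    rw [hq, ← Real.rpow_natCast, ← Real.rpow_mul hApos.le]
    push_cast
    rw [one_div_mul_cancel (by positivity), Real.rpow_one]
  have hk1 : k + 3 - 1 = k + 2 := by omega
  have hk2 : k + 3 - 2 = k + 1 := by omega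
  have hq5 : 5 * ((k + 3 : ℕ) : ℝ) ^ 2 < q := by
    rw [hk1, ← hqA] at hbig
    exact lt_of_pow_lt_pow_left₀ _ hqpos.le hbig
  have hq45 : 45 < q := by
    push_cast at hq5
    nlinarith
  have hexp : A ^ (((k + 3 : ℕ) : ℝ) / (((k + 3 : ℕ) : ℝ) - 1)) = A * q := by
    have e : (((k + 3 : ℕ) : ℝ) / (((k + 3 : ℕ) : ℝ) - 1)) = 1 + 1 / ((k:ℝ) + 2) := by
      push_cast
      have h1 : (k:ℝ) + 3 - 1 = k + 2 := by ring
      rw [h1]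
      field_simp
      ring
    rw [e, Real.rpow_add hApos, Real.rpow_one, hq]
  rw [hexp] at hcon
  obtain ⟨ρ, hρ⟩ : ∃ ρ : ℝ, q = ρ + 2 := ⟨q - 2, by ring⟩
  have hρ43 : 43 < ρ := by linarith
  have hAB : A * q - 3 * A = A * (ρ - 1) := by rw [hρ]; ring
  rw [hAB] at hcon
  have hBpos : 0 < A * (ρ - 1) := mul_pos hApos (by linarith)
  obtain ⟨c, hc1, hc2⟩ := exists_between hcon
  have hctop : c ≠ ⊤ := (hc2.trans ENNReal.ofReal_lt_top).ne
  have hcpos : 0 < c.toReal := ENNReal.toReal_pos (ne_bot_of_gt hc1) hctop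
  have hcB : c.toReal < A * (ρ - 1) := by
    rwa [ENNReal.lt_ofReal_iff_toReal_lt hctop] at hc2
  have hcmem : c.toReal ∉ individualExps Θ := by
    intro h
    have h1 : ENNReal.ofReal c.toReal ≤ betaExp Θ := le_sSup ⟨_, h, rfl⟩
    rw [ENNReal.ofReal_toReal hctop] at h1
    exact absurd hc1 (not_lt.2 h1)
  obtain ⟨T1, hT1⟩ := hI_of_notMem Θ c.toReal hcpos hcmem
  have hge := pow_add_two_ge ρ (by linarith) (k + 1)
  have hpw1 : 1 < ρ ^ (k + 1) := one_lt_pow₀ (by linarith) (by omega)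
  have hAρ : (ρ + 2) ^ (k + 1 + 1) = A := by rw [← hρ]; exact hqA
  rw [hAρ] at hge
  push_cast at hge
  have hx1 : c.toReal / (ρ - 1) < A := by rw [div_lt_iff₀ (by linarith)]; exact hcB
  have hx2 : ρ ^ (k + 2) + ((k + 3 : ℕ) : ℝ) * ρ ^ (k + 1) + 1 < A := by
    push_cast
    have : 0 ≤ (k:ℝ) * ρ ^ (k + 1) := by positivity
    have e : k + 1 + 1 = k + 2 := rfl
    rw [e] at hge
    nlinarith
  have hx3 : ((k + 3 : ℕ) : ℝ) * ρ ^ (k + 1) + ρ < A := by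
    have : ρ ≤ ρ ^ (k + 2) := le_self_pow₀ (by linarith) (by omega)
    linarith
  obtain ⟨s, hs1, hs2⟩ := exists_between (max_lt hx1 (max_lt hx2 hx3))
  obtain ⟨hs3, hs4⟩ := max_lt_iff.1 hs1
  obtain ⟨hs4, hs5⟩ := max_lt_iff.1 hs4
  have hlt : ENNReal.ofReal s < alphaExp Θ := by
    rw [← ENNReal.ofReal_toReal hfin]
    exact (ENNReal.ofReal_lt_ofReal_iff hApos).2 hs2
  obtain ⟨_, ⟨γ', hγ', rfl⟩, hsγ⟩ := lt_sSup_iff.1 hlt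
  have hsγ' : s < γ' := (ENNReal.ofReal_lt_ofReal_iff hγ'.1).1 hsγ
  refine main_contra hm hn Θ hpos' s ρ (hU_of_mem Θ γ' s hγ' hsγ') ⟨T1, fun u hu hTu => ?_⟩
    (by linarith) (by rw [hk2]; exact hs5.le) (by rw [hk1, hk2]; exact hs4)
  refine le_trans ?_ (hT1 u hu hTu)
  have hh : (1:ℝ) ≤ heightM u := by exact_mod_cast one_le_heightM hu
  refine Real.rpow_le_rpow_of_exponent_le hh (neg_le_neg ?_)
  rw [div_lt_iff₀ (by linarith)] at hs3
  exact hs3.le
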